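/- Topological invariance of simplicial homology: Let S and Q be geometric simplicial complexes (in ℝ^d and ℝ^e). If the polyhedra |S| and |Q| are homeomorphic, then for every m ≥ 0 the 𝔽₂-homology groups H_m(S) and H_m(Q) are isomorphic as 𝔽₂-vector spaces. -/

import Mathlib

open scoped Classical
open Finset

/-- A finite geometric simplicial complex in a real vector space `E`: a finite
collection of vertex sets of geometric simplices (finite affinely independent sets),
closed under passing to nonempty subsets (faces), such that the intersection of any two
of its geometric simplices (convex hulls of the vertex sets) is a face of each. -/
structure GeomComplex (E : Type*) [AddCommGroup E] [Module ℝ E] where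
  faces : Finset (Finset E)
  nonempty_of_mem : ∀ σ ∈ faces, σ.Nonempty
  indep : ∀ σ ∈ faces, AffineIndependent ℝ ((↑) : σ → E)
  down_closed : ∀ σ ∈ faces, ∀ τ ⊆ σ, τ.Nonempty → τ ∈ faces
  inter_face : ∀ σ ∈ faces, ∀ τ ∈ faces,
    convexHull ℝ (σ : Set E) ∩ convexHull ℝ (τ : Set E) =
      convexHull ℝ ((σ ∩ τ : Finset E) : Set E)

variable {E : Type*} [AddCommGroup E] [Module ℝ E]

/-- The polyhedron of a geometric simplicial complex: the union of its simplices. -/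
def GeomComplex.space (S : GeomComplex E) : Set E :=
  ⋃ σ ∈ S.faces, convexHull ℝ (σ : Set E)

/-- The type of (vertex sets of) `m`-simplices of `S`. -/
abbrev GeomComplex.Simp (S : GeomComplex E) (m : ℕ) : Type _ :=
  {σ : Finset E // σ ∈ S.faces ∧ σ.card = m + 1}

noncomputable instance (S : GeomComplex E) (m : ℕ) : Fintype (S.Simp m) :=
  Fintype.ofInjective (fun σ : S.Simp m => (⟨σ.1, σ.2.1⟩ : ↥S.faces))
    (fun _ _ hab => by
      have h2 := congrArg Subtype.val hab
      exact Subtype.ext h2)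

/-- The `𝔽₂`-vector space `C_m(S)` of `m`-chains of `S`, with basis the set of
`m`-simplices of `S`. -/
abbrev GeomComplex.Chain (S : GeomComplex E) (m : ℕ) : Type _ :=
  S.Simp m → ZMod 2

/-- The boundary operator `∂ : C_m(S) → C_{m-1}(S)`, sending an `m`-simplex to the sum
of its `(m-1)`-faces. -/
noncomputable def GeomComplex.bd (S : GeomComplex E) (m : ℕ) :
    S.Chain m →ₗ[ZMod 2] S.Chain (m - 1) where
  toFun c := fun τ => ∑ σ : S.Simp m, if (τ.1 : Finset E) ⊆ σ.1 then c σ else 0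
  map_add' c c' := by
    funext τ
    simp only [Pi.add_apply]
    rw [← Finset.sum_add_distrib]
    refine Finset.sum_congr rfl fun σ _ => ?_
    by_cases h : (τ.1 : Finset E) ⊆ σ.1 <;> simp [h]
  map_smul' r c := by
    funext τ
    simp only [Pi.smul_apply, RingHom.id_apply, Finset.smul_sum]
    refine Finset.sum_congr rfl fun σ _ => ?_
    by_cases h : (τ.1 : Finset E) ⊆ σ.1 <;> simp [h]

/-- The cycles `Z_m(S)`: the kernel of `∂ : C_m(S) → C_{m-1}(S)` for `m ≥ 1`, and all
of `C_0(S)` for `m = 0`. -/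
noncomputable def GeomComplex.cycles (S : GeomComplex E) (m : ℕ) :
    Submodule (ZMod 2) (S.Chain m) :=
  if m = 0 then ⊤ else LinearMap.ker (S.bd m)

/-- The boundaries `B_m(S)`: the image of `∂ : C_{m+1}(S) → C_m(S)`. -/
noncomputable def GeomComplex.bdries (S : GeomComplex E) (m : ℕ) :
    Submodule (ZMod 2) (S.Chain m) :=
  LinearMap.range (S.bd (m + 1))

namespace SimplicialInvariance

/-- The `𝔽₂`-chains on all finite subsets of `α`, the empty set included (so that the boundary
operator below is the augmented one). -/
abbrev FChain (α : Type*) : Type _ := Finset α →₀ ZMod 2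

/-- The basis chain of a finite set. -/
noncomputable def el {α : Type*} (σ : Finset α) : FChain α := Finsupp.single σ 1

/-- The linear map with prescribed values on the basis chains. -/
noncomputable def lift {α M : Type*} [AddCommGroup M] [Module (ZMod 2) M] (f : Finset α → M) :
    FChain α →ₗ[ZMod 2] M := Finsupp.linearCombination (ZMod 2) f

@[simp] lemma lift_el {α M : Type*} [AddCommGroup M] [Module (ZMod 2) M] (f : Finset α → M)
    (σ : Finset α) : lift f (el σ) = f σ := by
  simp [lift, el]

/-- The augmented boundary operator. -/
noncomputable def bdry {α : Type*} : FChain α →ₗ[ZMod 2] FChain α :=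
  lift fun σ => ∑ v ∈ σ, el (σ.erase v)

lemma bdry_el {α : Type*} (σ : Finset α) : bdry (el σ) = ∑ v ∈ σ, el (σ.erase v) := by
  simp [bdry]

@[simp] lemma bdry_el_empty {α : Type*} : bdry (el (∅ : Finset α)) = 0 := by
  simp [bdry_el]

/-- The cone operator with apex `b`. -/
noncomputable def cone {α : Type*} (b : α) : FChain α →ₗ[ZMod 2] FChain α :=
  lift fun σ => if b ∈ σ then 0 else el (insert b σ)

lemma cone_el {α : Type*} (b : α) (σ : Finset α) :
    cone b (el σ) = if b ∈ σ then 0 else el (insert b σ) := by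
  simp [cone]

lemma hom_ext {α M : Type*} [AddCommGroup M] [Module (ZMod 2) M] {F G : FChain α →ₗ[ZMod 2] M}
    (h : ∀ σ, F (el σ) = G (el σ)) : F = G :=
  Finsupp.lhom_ext' fun σ => LinearMap.ext_ring (h σ)

lemma bdry_cone_el {α : Type*} (b : α) (σ : Finset α) :
    bdry (cone b (el σ)) + cone b (bdry (el σ)) = el σ := by
  by_cases hb : b ∈ σ
  · rw [cone_el, if_pos hb, map_zero, zero_add, bdry_el, map_sum,
      Finset.sum_eq_single_of_mem b hb]
    · rw [cone_el, if_neg (Finset.notMem_erase b σ), Finset.insert_erase hb]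
    · intro v _ hv
      rw [cone_el, if_pos (Finset.mem_erase.2 ⟨hv.symm, hb⟩)]
  · rw [cone_el, if_neg hb, bdry_el, bdry_el, Finset.sum_insert hb, Finset.erase_insert hb,
      map_sum, add_assoc, ← Finset.sum_add_distrib, Finset.sum_eq_zero, add_zero]
    intro v hv
    have hvb : b ≠ v := fun h => hb (h ▸ hv)
    rw [cone_el, if_neg (fun h => hb (Finset.mem_of_mem_erase h)),
      Finset.erase_insert_of_ne hvb, ZModModule.add_self]

lemma bdry_cone {α : Type*} (b : α) (c : FChain α) :
    bdry (cone b c) + cone b (bdry c) = c := by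
  have : bdry ∘ₗ cone b + cone b ∘ₗ bdry = LinearMap.id := hom_ext fun σ => bdry_cone_el b σ
  exact LinearMap.congr_fun this c

lemma bdry_bdry_el {α : Type*} (σ : Finset α) : bdry (bdry (el σ)) = 0 := by
  induction σ using Finset.induction_on with
  | empty => simp
  | insert b τ hb ih =>
    have h1 : el (insert b τ) = cone b (el τ) := by rw [cone_el, if_neg hb]
    have h2 := bdry_cone b (bdry (el τ))
    rw [ih, map_zero, add_zero] at h2
    have h3 := congrArg bdry (bdry_cone b (el τ))
    rw [map_add, h2] at h3
    rw [h1]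
    simpa using h3

lemma bdry_bdry {α : Type*} (c : FChain α) : bdry (bdry c) = 0 := by
  have : bdry ∘ₗ bdry = (0 : FChain α →ₗ[ZMod 2] FChain α) := hom_ext fun σ => bdry_bdry_el σ
  exact LinearMap.congr_fun this c

/-- The chains supported on the members of `A` with `n` elements. -/
noncomputable def chains {α : Type*} (A : Set (Finset α)) (n : ℕ) :
    Submodule (ZMod 2) (FChain α) :=
  Finsupp.supported (ZMod 2) (ZMod 2) {σ | σ ∈ A ∧ σ.card = n}

lemma el_mem_chains {α : Type*} {A : Set (Finset α)} {σ : Finset α} (h : σ ∈ A) {n : ℕ}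
    (hn : σ.card = n) : el σ ∈ chains A n :=
  Finsupp.single_mem_supported _ _ ⟨h, hn⟩

lemma chains_mono {α : Type*} {A B : Set (Finset α)} (h : A ⊆ B) (n : ℕ) :
    chains A n ≤ chains B n :=
  Finsupp.supported_mono fun _ hσ => ⟨h hσ.1, hσ.2⟩

lemma chains_le {α : Type*} {A : Set (Finset α)} {n : ℕ} {P : Submodule (ZMod 2) (FChain α)}
    (h : ∀ σ ∈ A, σ.card = n → el σ ∈ P) : chains A n ≤ P := by
  rw [chains, Finsupp.supported_eq_span_single, Submodule.span_le]
  rintro _ ⟨σ, hσ, rfl⟩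
  exact h σ hσ.1 hσ.2

lemma map_mem_chains {α β : Type*} {A : Set (Finset α)} {B : Set (Finset β)} {n k : ℕ}
    {F : FChain α →ₗ[ZMod 2] FChain β} (h : ∀ σ ∈ A, σ.card = n → F (el σ) ∈ chains B k)
    {c : FChain α} (hc : c ∈ chains A n) : F c ∈ chains B k :=
  chains_le (P := (chains B k).comap F) h hc

lemma eq_on_chains {α β : Type*} {A : Set (Finset α)} {n : ℕ}
    {F G : FChain α →ₗ[ZMod 2] FChain β} (h : ∀ σ ∈ A, σ.card = n → F (el σ) = G (el σ))
    {c : FChain α} (hc : c ∈ chains A n) : F c = G c :=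
  chains_le (P := LinearMap.eqLocus F G) h hc

/-- Closure under passing to subsets. -/
def DownClosed {α : Type*} (A : Set (Finset α)) : Prop := ∀ σ ∈ A, ∀ τ ⊆ σ, τ ∈ A

lemma bdry_mem_chains {α : Type*} {A : Set (Finset α)} (hA : DownClosed A) {n : ℕ}
    {c : FChain α} (hc : c ∈ chains A (n + 1)) : bdry c ∈ chains A n := by
  refine map_mem_chains (fun σ hσ hn => ?_) hc
  rw [bdry_el]
  refine Submodule.sum_mem _ fun v hv => el_mem_chains (hA σ hσ _ (Finset.erase_subset v σ)) ?_
  rw [Finset.card_erase_of_mem hv, hn, Nat.add_sub_cancel]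

/-- Vanishing of the augmented homology. -/
def Acyclic {α : Type*} (A : Set (Finset α)) : Prop :=
  ∀ n, ∀ z ∈ chains A n, bdry z = 0 → ∃ w ∈ chains A (n + 1), bdry w = z

lemma exists_bdry_eq_of_insert_mem {α : Type*} {A B : Set (Finset α)} {b : α}
    (h : ∀ σ ∈ A, insert b σ ∈ B) {n : ℕ} {z : FChain α} (hz : z ∈ chains A n)
    (hz0 : bdry z = 0) : ∃ w ∈ chains B (n + 1), bdry w = z := by
  refine ⟨cone b z, map_mem_chains (fun σ hσ hn => ?_) hz, ?_⟩
  · rw [cone_el]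
    split_ifs with hb
    · exact Submodule.zero_mem _
    · exact el_mem_chains (h σ hσ) (by rw [Finset.card_insert_of_notMem hb, hn])
  · have := bdry_cone b z
    rwa [hz0, map_zero, add_zero] at this

/-- The full simplex on a finite vertex set. -/
def simplex {α : Type*} (s : Finset α) : Set (Finset α) := {σ | σ ⊆ s}

lemma acyclic_simplex {α : Type*} {s : Finset α} (hs : s.Nonempty) : Acyclic (simplex s) := by
  obtain ⟨b, hb⟩ := hs
  exact fun n z hz hz0 => exists_bdry_eq_of_insert_mem
    (fun σ hσ => Finset.insert_subset hb hσ) hz hz0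

/-- A recursively chosen solution `L` of `∂ L σ = L ∂ σ + D σ` carried by `Φ`. -/
noncomputable def carriedSolution {α β : Type*} (Φ : Finset α → Set (Finset β)) (k : ℕ)
    (D : FChain α →ₗ[ZMod 2] FChain β) (a : FChain β) (σ : Finset α) : FChain β :=
  if σ = ∅ then a
  else if h : ∃ w ∈ chains (Φ σ) (σ.card + k),
      bdry w = ∑ v : σ, carriedSolution Φ k D a (σ.erase v) + D (el σ)
    then h.choose else 0
termination_by σ.card
decreasing_by exact Finset.card_erase_lt_of_mem v.2

/-- The obstruction form of the acyclic carrier theorem. -/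
theorem exists_carried {α β : Type*} {K : Set (Finset α)} (hK : DownClosed K)
    {Φ : Finset α → Set (Finset β)} (hmono : ∀ σ ∈ K, ∀ τ ⊆ σ, Φ τ ⊆ Φ σ)
    (hac : ∀ σ ∈ K, σ.Nonempty → Acyclic (Φ σ)) (k : ℕ)
    (D : FChain α →ₗ[ZMod 2] FChain β) (a : FChain β)
    (hD : ∀ σ ∈ K, ∀ n, n + 1 = σ.card + k → D (el σ) ∈ chains (Φ σ) n)
    (hcomm : ∀ σ ∈ K, bdry (D (el σ)) = D (bdry (el σ)))
    (ha : a ∈ chains (Φ ∅) k) (hbdry : bdry a = D (el ∅)) :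
    ∃ L : FChain α →ₗ[ZMod 2] FChain β, L (el ∅) = a ∧
      ∀ σ ∈ K, L (el σ) ∈ chains (Φ σ) (σ.card + k) ∧
        bdry (L (el σ)) = L (bdry (el σ)) + D (el σ) := by
  refine ⟨lift (carriedSolution Φ k D a), ?_, ?_⟩
  · rw [lift_el, carriedSolution, if_pos rfl]
  set L := lift (carriedSolution Φ k D a) with hL
  intro σ
  induction hn : σ.card using Nat.strong_induction_on generalizing σ with
  | _ n ih =>
  intro hσ
  subst hn
  rcases σ.eq_empty_or_nonempty with rfl | hne
  · have : L (el ∅) = a := by rw [hL, lift_el, carriedSolution, if_pos rfl]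
    rw [this, bdry_el_empty, map_zero, zero_add, Finset.card_empty, Nat.zero_add]
    exact ⟨ha, hbdry⟩
  · have hface : ∀ v ∈ σ, σ.erase v ∈ K ∧ (σ.erase v).card < σ.card := fun v hv =>
      ⟨hK σ hσ _ (Finset.erase_subset _ _), Finset.card_erase_lt_of_mem hv⟩
    obtain ⟨n, hcard⟩ : ∃ n, n + 1 = σ.card := ⟨σ.card - 1, by have := hne.card_pos; omega⟩
    have hsum : L (bdry (el σ)) = ∑ v : σ, carriedSolution Φ k D a (σ.erase v) := by
      rw [bdry_el, map_sum, ← Finset.sum_coe_sort]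
      exact Finset.sum_congr rfl fun v _ => by rw [hL, lift_el]
    have hmem : L (bdry (el σ)) + D (el σ) ∈ chains (Φ σ) (n + k) := by
      refine Submodule.add_mem _ ?_ (hD σ hσ _ (by omega))
      rw [bdry_el, map_sum]
      refine Submodule.sum_mem _ fun v hv => ?_
      have := (ih _ (hface v hv).2 _ rfl (hface v hv).1).1
      rw [Finset.card_erase_of_mem hv, ← hcard, Nat.add_sub_cancel] at this
      exact chains_mono (hmono σ hσ _ (Finset.erase_subset _ _)) _ this
    have hcyc : bdry (L (bdry (el σ)) + D (el σ)) = 0 := by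
      have h1 : bdry (L (bdry (el σ))) = L (bdry (bdry (el σ))) + D (bdry (el σ)) := by
        rw [bdry_el σ]
        simp only [map_sum]
        rw [← Finset.sum_add_distrib]
        exact Finset.sum_congr rfl fun v hv => (ih _ (hface v hv).2 _ rfl (hface v hv).1).2
      rw [map_add, h1, bdry_bdry, map_zero, zero_add, hcomm σ hσ, ZModModule.add_self]
    have hex : ∃ w ∈ chains (Φ σ) (σ.card + k),
        bdry w = ∑ v : σ, carriedSolution Φ k D a (σ.erase v) + D (el σ) := by
      rw [← hsum, ← hcard, Nat.add_right_comm]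
      exact hac σ hσ hne _ _ hmem hcyc
    have hval : L (el σ) = hex.choose := by
      rw [hL, lift_el, carriedSolution, if_neg hne.ne_empty, dif_pos hex]
    rw [hval, hsum]
    exact hex.choose_spec

/-- `F` is an augmentation preserving chain map on the complex `K`, carried by `Φ`. -/
structure IsCarried {α β : Type*} (K : Set (Finset α)) (Φ : Finset α → Set (Finset β))
    (F : FChain α →ₗ[ZMod 2] FChain β) : Prop where
  empty : F (el ∅) = el ∅
  comm : ∀ σ ∈ K, bdry (F (el σ)) = F (bdry (el σ))
  mem : ∀ σ ∈ K, F (el σ) ∈ chains (Φ σ) σ.card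

/-- `F` and `G` are chain homotopic as maps from the complex `K` to the complex `L`. -/
def Homotopic {α β : Type*} (K : Set (Finset α)) (L : Set (Finset β))
    (F G : FChain α →ₗ[ZMod 2] FChain β) : Prop :=
  ∃ h : FChain α →ₗ[ZMod 2] FChain β, h (el ∅) = 0 ∧
    ∀ σ ∈ K, h (el σ) ∈ chains L (σ.card + 1) ∧
      bdry (h (el σ)) + h (bdry (el σ)) = F (el σ) + G (el σ)

/-- Existence in the acyclic carrier theorem. -/
theorem exists_isCarried {α β : Type*} {K : Set (Finset α)} (hK : DownClosed K)
    {Φ : Finset α → Set (Finset β)} (hmono : ∀ σ ∈ K, ∀ τ ⊆ σ, Φ τ ⊆ Φ σ)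
    (hac : ∀ σ ∈ K, σ.Nonempty → Acyclic (Φ σ)) (hempty : ∅ ∈ Φ ∅) :
    ∃ F : FChain α →ₗ[ZMod 2] FChain β, IsCarried K Φ F := by
  obtain ⟨F, h0, h⟩ := exists_carried hK hmono hac 0 0 (el ∅)
    (fun _ _ _ _ => Submodule.zero_mem _) (fun _ _ => by simp) (el_mem_chains hempty rfl)
    (by simp)
  exact ⟨F, h0, fun σ hσ => by simpa using (h σ hσ).2, fun σ hσ => (h σ hσ).1⟩

/-- Uniqueness in the acyclic carrier theorem. -/
theorem IsCarried.homotopic {α β : Type*} {K : Set (Finset α)} (hK : DownClosed K)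
    {Φ : Finset α → Set (Finset β)} (hmono : ∀ σ ∈ K, ∀ τ ⊆ σ, Φ τ ⊆ Φ σ)
    (hac : ∀ σ ∈ K, σ.Nonempty → Acyclic (Φ σ)) {L : Set (Finset β)} (hL : ∀ σ ∈ K, Φ σ ⊆ L)
    {F G : FChain α →ₗ[ZMod 2] FChain β} (hF : IsCarried K Φ F) (hG : IsCarried K Φ G) :
    Homotopic K L F G := by
  obtain ⟨h, h0, hh⟩ := exists_carried hK hmono hac 1 (F + G) 0
    (fun σ hσ n hn => by
      obtain rfl : n = σ.card := by omega
      exact Submodule.add_mem _ (hF.mem σ hσ) (hG.mem σ hσ))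
    (fun σ hσ => by simp [hF.comm σ hσ, hG.comm σ hσ]) (Submodule.zero_mem _)
    (by simp [hF.empty, hG.empty, ZModModule.add_self])
  refine ⟨h, h0, fun σ hσ => ⟨chains_mono (hL σ hσ) _ (hh σ hσ).1, ?_⟩⟩
  rw [(hh σ hσ).2, add_right_comm, ZModModule.add_self, zero_add, LinearMap.add_apply]

section Maps

variable {α β γ : Type*} {K : Set (Finset α)} {L : Set (Finset β)} {M : Set (Finset γ)}

lemma IsCarried.mono {Φ Ψ : Finset α → Set (Finset β)} {F : FChain α →ₗ[ZMod 2] FChain β}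
    (hF : IsCarried K Φ F) (h : ∀ σ ∈ K, Φ σ ⊆ Ψ σ) : IsCarried K Ψ F :=
  ⟨hF.empty, hF.comm, fun σ hσ => chains_mono (h σ hσ) _ (hF.mem σ hσ)⟩

lemma IsCarried.comm_of_mem {Φ : Finset α → Set (Finset β)} {F : FChain α →ₗ[ZMod 2] FChain β}
    (hF : IsCarried K Φ F) {n : ℕ} {c : FChain α} (hc : c ∈ chains K n) :
    bdry (F c) = F (bdry c) :=
  eq_on_chains (F := bdry ∘ₗ F) (G := F ∘ₗ bdry) (fun σ hσ _ => hF.comm σ hσ) hc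

lemma IsCarried.map_mem {F : FChain α →ₗ[ZMod 2] FChain β}
    (hF : IsCarried K (fun _ => L) F) {n : ℕ} {c : FChain α} (hc : c ∈ chains K n) :
    F c ∈ chains L n :=
  map_mem_chains (fun σ hσ hn => hn ▸ hF.mem σ hσ) hc

lemma isCarried_id {Φ : Finset α → Set (Finset α)} (h : ∀ σ ∈ K, σ ∈ Φ σ) :
    IsCarried K Φ LinearMap.id :=
  ⟨rfl, fun _ _ => rfl, fun σ hσ => el_mem_chains (h σ hσ) rfl⟩

lemma IsCarried.comp {Φ : Finset α → Set (Finset β)} {Ψ : Finset β → Set (Finset γ)}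
    {Ω : Finset α → Set (Finset γ)} {F : FChain α →ₗ[ZMod 2] FChain β}
    {G : FChain β →ₗ[ZMod 2] FChain γ} (hG : IsCarried L Ψ G) (hF : IsCarried K Φ F)
    (hL : ∀ σ ∈ K, Φ σ ⊆ L) (hΩ : ∀ σ ∈ K, ∀ τ ∈ Φ σ, Ψ τ ⊆ Ω σ) :
    IsCarried K Ω (G ∘ₗ F) where
  empty := by rw [LinearMap.comp_apply, hF.empty, hG.empty]
  comm σ hσ := by
    rw [LinearMap.comp_apply, hG.comm_of_mem (chains_mono (hL σ hσ) _ (hF.mem σ hσ)),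
      hF.comm σ hσ, LinearMap.comp_apply]
  mem σ hσ := map_mem_chains
    (fun τ hτ hn => chains_mono (hΩ σ hσ τ hτ) _ (hn ▸ hG.mem τ (hL σ hσ hτ))) (hF.mem σ hσ)

lemma Homotopic.trans {F G H : FChain α →ₗ[ZMod 2] FChain β} (h₁ : Homotopic K L F G)
    (h₂ : Homotopic K L G H) : Homotopic K L F H := by
  obtain ⟨a, a0, ha⟩ := h₁
  obtain ⟨b, b0, hb⟩ := h₂
  refine ⟨a + b, by simp [a0, b0], fun σ hσ =>
    ⟨Submodule.add_mem _ (ha σ hσ).1 (hb σ hσ).1, ?_⟩⟩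
  have e := congrArg₂ (· + ·) (ha σ hσ).2 (hb σ hσ).2
  rw [LinearMap.add_apply, LinearMap.add_apply, map_add, add_add_add_comm, e, add_assoc,
    ← add_assoc (G _), ZModModule.add_self, zero_add]

lemma Homotopic.comp_left {F G : FChain α →ₗ[ZMod 2] FChain β} (h : Homotopic K L F G)
    {P : FChain β →ₗ[ZMod 2] FChain γ} (hP : IsCarried L (fun _ => M) P) :
    Homotopic K M (P ∘ₗ F) (P ∘ₗ G) := by
  obtain ⟨a, a0, ha⟩ := h
  refine ⟨P ∘ₗ a, by simp [a0], fun σ hσ => ⟨hP.map_mem (ha σ hσ).1, ?_⟩⟩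
  simp only [LinearMap.comp_apply]
  rw [hP.comm_of_mem (ha σ hσ).1, ← map_add, (ha σ hσ).2, map_add]

lemma Homotopic.comp_right {F G : FChain β →ₗ[ZMod 2] FChain γ} (h : Homotopic L M F G)
    {P : FChain α →ₗ[ZMod 2] FChain β} (hP : IsCarried K (fun _ => L) P) :
    Homotopic K M (F ∘ₗ P) (G ∘ₗ P) := by
  obtain ⟨a, a0, ha⟩ := h
  refine ⟨a ∘ₗ P, by simp [hP.empty, a0], fun σ hσ => ⟨?_, ?_⟩⟩
  · exact map_mem_chains (F := a) (fun τ hτ hn => hn ▸ (ha τ hτ).1) (hP.mem σ hσ)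
  simp only [LinearMap.comp_apply]
  rw [← hP.comm σ hσ]
  exact eq_on_chains (F := bdry ∘ₗ a + a ∘ₗ bdry) (G := F + G)
    (fun τ hτ _ => (ha τ hτ).2) (hP.mem σ hσ)

lemma Homotopic.exists_bdry_eq {F G : FChain α →ₗ[ZMod 2] FChain β} (h : Homotopic K L F G)
    {n : ℕ} {z : FChain α} (hz : z ∈ chains K n) {t : ZMod 2} (hz0 : bdry z = t • el ∅) :
    ∃ w ∈ chains L (n + 1), bdry w = F z + G z := by
  obtain ⟨a, a0, ha⟩ := h
  refine ⟨a z, map_mem_chains (fun τ hτ hn => hn ▸ (ha τ hτ).1) hz, ?_⟩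
  have e := eq_on_chains (F := bdry ∘ₗ a + a ∘ₗ bdry) (G := F + G) (fun τ hτ _ => (ha τ hτ).2) hz
  simpa [hz0, a0] using e

/-- Chain maps carried by the images of a vertex map. -/
lemma exists_isCarried_simplex_image (hK : DownClosed K) (f : α → β) :
    ∃ F : FChain α →ₗ[ZMod 2] FChain β, IsCarried K (fun σ => simplex (σ.image f)) F :=
  exists_isCarried hK (fun _ _ _ hτ _ hρ => hρ.trans (Finset.image_subset_image hτ))
    (fun _ _ hne => acyclic_simplex (hne.image f)) (Finset.empty_subset _)

end Maps

section Vietoris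

variable {F : Type*} [NormedAddCommGroup F]

/-- The Vietoris–Rips complex of `A` at scale `ε`. -/
def vietoris (A : Set F) (ε : ℝ) : Set (Finset F) :=
  {σ | (σ : Set F) ⊆ A ∧ ∀ x ∈ σ, ∀ y ∈ σ, dist x y < ε}

lemma downClosed_vietoris (A : Set F) (ε : ℝ) : DownClosed (vietoris A ε) :=
  fun _ hσ _ hτ => ⟨(Finset.coe_subset.2 hτ).trans hσ.1,
    fun x hx y hy => hσ.2 x (hτ hx) y (hτ hy)⟩

lemma vietoris_mono {A B : Set F} (h : A ⊆ B) (ε : ℝ) : vietoris A ε ⊆ vietoris B ε :=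
  fun _ hσ => ⟨hσ.1.trans h, hσ.2⟩

lemma empty_mem_vietoris (A : Set F) (ε : ℝ) : ∅ ∈ vietoris A ε := by
  simp [vietoris]

/-- A map that is fine enough on a set carries simplices of a Vietoris–Rips complex to simplices
of another one. -/
lemma simplex_image_subset_vietoris {G : Type*} [NormedAddCommGroup G] {A : Set F} {B : Set G}
    {f : F → G} {ε δ : ℝ}
    (hf : Set.MapsTo f A B) (h : ∀ x ∈ A, ∀ y ∈ A, dist x y < ε → dist (f x) (f y) < δ)
    {σ : Finset F} (hσ : σ ∈ vietoris A ε) : simplex (σ.image f) ⊆ vietoris B δ := by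
  refine fun τ hτ => downClosed_vietoris B δ (σ.image f) ⟨?_, ?_⟩ τ hτ
  · intro x hx
    obtain ⟨y, hy, rfl⟩ := Finset.mem_image.1 (Finset.mem_coe.1 hx)
    exact hf (hσ.1 hy)
  · intro x hx y hy
    obtain ⟨x, hxσ, rfl⟩ := Finset.mem_image.1 hx
    obtain ⟨y, hyσ, rfl⟩ := Finset.mem_image.1 hy
    exact h x (hσ.1 hxσ) y (hσ.1 hyσ) (hσ.2 x hxσ y hyσ)

/-- Uniform continuity of a continuous map on a compact set, phrased for an extension. -/
lemma exists_uniform_extension {G : Type*} [NormedAddCommGroup G] {A : Set F} {B : Set G}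
    (hA : IsCompact A) (f : A → B)
    (hf : Continuous f) (f' : F → G) (hf' : ∀ x : A, f' x = f x) {δ : ℝ} (hδ : 0 < δ) :
    ∃ ε > 0, ∀ x ∈ A, ∀ y ∈ A, dist x y < ε → dist (f' x) (f' y) < δ := by
  have := isCompact_iff_compactSpace.1 hA
  obtain ⟨ε, hε, h⟩ := Metric.uniformContinuous_iff.1
    (CompactSpace.uniformContinuous_of_continuous hf) δ hδ
  refine ⟨ε, hε, fun x hx y hy hxy => ?_⟩
  rw [hf' ⟨x, hx⟩, hf' ⟨y, hy⟩]
  exact h (a := ⟨x, hx⟩) (b := ⟨y, hy⟩) hxy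

/-- The part of the closed Vietoris–Rips complex of `A` at scale `r` lying within distance `R`
of `b`. -/
def boundedVietoris (A : Set F) (b : F) (r R : ℝ) : Set (Finset F) :=
  {σ | (σ : Set F) ⊆ A ∧ (∀ x ∈ σ, ∀ y ∈ σ, dist x y ≤ r) ∧ ∀ x ∈ σ, dist x b ≤ R}

lemma downClosed_boundedVietoris (A : Set F) (b : F) (r R : ℝ) :
    DownClosed (boundedVietoris A b r R) :=
  fun _ hσ _ hτ => ⟨(Finset.coe_subset.2 hτ).trans hσ.1,
    fun x hx y hy => hσ.2.1 x (hτ hx) y (hτ hy), fun x hx => hσ.2.2 x (hτ hx)⟩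

lemma exists_mem_boundedVietoris {A : Set F} {b : F} {ε : ℝ} {n : ℕ} {z : FChain F}
    (hz : z ∈ chains (vietoris A ε) n) (hε : 0 < ε) :
    ∃ r R : ℝ, r < ε ∧ 0 ≤ R ∧ z ∈ chains (boundedVietoris A b r R) n := by
  have hz' : ∀ σ ∈ z.support, σ ∈ vietoris A ε ∧ σ.card = n := fun σ hσ =>
    (Finsupp.mem_supported _ _).1 hz hσ
  have hr : ∀ s : Finset (Finset F), (∀ σ ∈ s, σ ∈ vietoris A ε) → ∃ r R : ℝ, r < ε ∧
      0 ≤ R ∧ ∀ σ ∈ s, σ ∈ boundedVietoris A b r R := by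
    intro s hs
    obtain ⟨r, hrε, hr⟩ : ∃ r : ℝ, r < ε ∧ ∀ σ ∈ s, ∀ x ∈ σ, ∀ y ∈ σ,
        dist x y ≤ r := by
      let T : Finset ℝ := insert 0 (s.biUnion fun σ => (σ ×ˢ σ).image fun p => dist p.1 p.2)
      have hT : T.Nonempty := Finset.insert_nonempty _ _
      refine ⟨T.max' hT, ?_, ?_⟩
      · rw [Finset.max'_lt_iff]
        intro t ht
        rcases Finset.mem_insert.1 ht with rfl | ht
        · exact hε
        · simp only [Finset.mem_biUnion, Finset.mem_image, Finset.mem_product] at ht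
          obtain ⟨σ, hσ, p, hp, rfl⟩ := ht
          exact (hs σ hσ).2 _ hp.1 _ hp.2
      · intro σ hσ x hx y hy
        refine T.le_max' _ (Finset.mem_insert_of_mem ?_)
        simp only [Finset.mem_biUnion, Finset.mem_image, Finset.mem_product]
        exact ⟨σ, hσ, (x, y), ⟨hx, hy⟩, rfl⟩
    obtain ⟨R, hR⟩ := ((s.biUnion id).image fun x => dist x b).bddAbove
    refine ⟨r, max R 0, hrε, le_max_right _ _, fun σ hσ => ⟨(hs σ hσ).1, hr σ hσ, ?_⟩⟩
    intro x hx
    refine le_max_of_le_left (hR ?_)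
    rw [Finset.mem_coe, Finset.mem_image]
    exact ⟨x, Finset.mem_biUnion.2 ⟨σ, hσ, hx⟩, rfl⟩
  obtain ⟨r, R, h1, h2, h⟩ := hr z.support fun σ hσ => (hz' σ hσ).1
  exact ⟨r, R, h1, h2, (Finsupp.mem_supported _ _).2 fun σ hσ => ⟨h σ hσ, (hz' σ hσ).2⟩⟩

variable [NormedSpace ℝ F]

/-- Contracting a star-convex set by a factor close to `1` does not change homology classes. -/
lemma exists_homologous_contraction {A : Set F} {b : F} (hA : StarConvex ℝ b A) {ε r R q : ℝ}
    (hrε : r < ε) (hq0 : 0 ≤ q) (hq1 : q ≤ 1) (hq : (1 - q) * R < ε - r) {n : ℕ}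
    {z : FChain F} (hz : z ∈ chains (boundedVietoris A b r R) n) (hz0 : bdry z = 0) :
    ∃ z' ∈ chains (boundedVietoris A b r (q * R)) n, bdry z' = 0 ∧
      ∃ w ∈ chains (vietoris A ε) (n + 1), bdry w = z + z' := by
  let f : F → F := fun x => AffineMap.lineMap b x q
  have hfA : ∀ x ∈ A, f x ∈ A := fun x hx => by
    have := hA hx (a := 1 - q) (b := q) (by linarith) hq0 (by ring)
    simpa [f, AffineMap.lineMap_apply_module] using this
  have hfd : ∀ x y, dist (f x) (f y) = q * dist x y := fun x y => by
    simp only [f, AffineMap.lineMap_apply_module, dist_eq_norm]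
    rw [add_sub_add_left_eq_sub, ← smul_sub, norm_smul, Real.norm_of_nonneg hq0]
  have hfb : ∀ x, dist (f x) b = q * dist x b := fun x => by
    simp [f, dist_lineMap_left, abs_of_nonneg hq0, dist_comm b x]
  have hfx : ∀ x, dist (f x) x = (1 - q) * dist x b := fun x => by
    simp only [f]
    rw [dist_lineMap_right, Real.norm_of_nonneg (by linarith), dist_comm]
  have hK := downClosed_boundedVietoris A b r R
  obtain ⟨G, hG⟩ := exists_isCarried_simplex_image hK f
  have hdist : ∀ σ ∈ boundedVietoris A b r R, ∀ x ∈ σ, ∀ y ∈ σ, dist (f x) y < ε := by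
    intro σ hσ x hx y hy
    have h1 := hσ.2.1 x hx y hy
    have h2 := hσ.2.2 x hx
    have h3 := dist_triangle (f x) x y
    have h4 : (1 - q) * dist x b ≤ (1 - q) * R := mul_le_mul_of_nonneg_left h2 (by linarith)
    rw [hfx] at h3
    linarith
  have hdist' : ∀ σ ∈ boundedVietoris A b r R, ∀ x ∈ σ, ∀ y ∈ σ, dist (f x) (f y) ≤ r := by
    intro σ hσ x hx y hy
    rw [hfd]
    exact (mul_le_of_le_one_left dist_nonneg hq1).trans (hσ.2.1 x hx y hy)
  have hhom : Homotopic (boundedVietoris A b r R) (vietoris A ε) LinearMap.id G := by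
    refine IsCarried.homotopic (Φ := fun σ => simplex (σ ∪ σ.image f)) hK ?_ ?_ ?_
      (isCarried_id fun σ _ => Finset.subset_union_left)
      (hG.mono fun σ _ τ hτ => Finset.Subset.trans hτ Finset.subset_union_right)
    · intro σ _ τ hτ ρ hρ
      exact Finset.Subset.trans hρ (Finset.union_subset_union hτ (Finset.image_subset_image hτ))
    · exact fun σ _ hne => acyclic_simplex (hne.mono Finset.subset_union_left)
    · intro σ hσ τ hτ
      refine downClosed_vietoris A ε _ ⟨?_, ?_⟩ τ hτ
      · intro x hx
        rcases Finset.mem_union.1 (Finset.mem_coe.1 hx) with hx | hx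
        · exact hσ.1 hx
        · obtain ⟨y, hy, rfl⟩ := Finset.mem_image.1 hx
          exact hfA y (hσ.1 hy)
      · intro x hx y hy
        rcases Finset.mem_union.1 hx with hx | hx <;> rcases Finset.mem_union.1 hy with hy | hy
        · exact (hσ.2.1 x hx y hy).trans_lt hrε
        · obtain ⟨y, hy', rfl⟩ := Finset.mem_image.1 hy
          rw [dist_comm]
          exact hdist σ hσ y hy' x hx
        · obtain ⟨x, hx', rfl⟩ := Finset.mem_image.1 hx
          exact hdist σ hσ x hx' y hy
        · obtain ⟨x, hx', rfl⟩ := Finset.mem_image.1 hx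
          obtain ⟨y, hy', rfl⟩ := Finset.mem_image.1 hy
          exact (hdist' σ hσ x hx' y hy').trans_lt hrε
  obtain ⟨w, hw, hwz⟩ := hhom.exists_bdry_eq hz (t := 0) (by simpa using hz0)
  refine ⟨G z, map_mem_chains (fun σ hσ hn => chains_mono ?_ _ (hn ▸ hG.mem σ hσ)) hz, ?_,
    w, hw, hwz⟩
  · intro τ hτ
    refine downClosed_boundedVietoris _ _ _ _ (σ.image f) ⟨?_, ?_, ?_⟩ τ hτ
    · intro x hx
      obtain ⟨y, hy, rfl⟩ := Finset.mem_image.1 (Finset.mem_coe.1 hx)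
      exact hfA y (hσ.1 hy)
    · intro x hx y hy
      obtain ⟨x, hx', rfl⟩ := Finset.mem_image.1 hx
      obtain ⟨y, hy', rfl⟩ := Finset.mem_image.1 hy
      exact hdist' σ hσ x hx' y hy'
    · intro x hx
      obtain ⟨x, hx', rfl⟩ := Finset.mem_image.1 hx
      rw [hfb]
      exact mul_le_mul_of_nonneg_left (hσ.2.2 x hx') hq0
  · rw [hG.comm_of_mem hz, hz0, map_zero]

/-- The Vietoris–Rips complex of a star-convex set is acyclic at every positive scale. -/
theorem acyclic_vietoris {A : Set F} {b : F} (hA : StarConvex ℝ b A) (hb : b ∈ A) {ε : ℝ}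
    (hε : 0 < ε) : Acyclic (vietoris A ε) := by
  intro n z hz hz0
  obtain ⟨r, R, hrε, hR0, hzr⟩ := exists_mem_boundedVietoris (b := b) hz hε
  obtain ⟨q, hq0, hq1, hq⟩ : ∃ q : ℝ, 0 ≤ q ∧ q < 1 ∧ (1 - q) * R < ε - r := by
    have hpos : 0 < R + (ε - r) := by linarith
    refine ⟨R / (R + (ε - r)), by positivity, (div_lt_one hpos).2 (by linarith), ?_⟩
    rw [one_sub_div hpos.ne', div_mul_eq_mul_div, div_lt_iff₀ hpos]
    nlinarith [mul_pos (sub_pos.2 hrε) (sub_pos.2 hrε)]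
  have hiter : ∀ k : ℕ, ∃ z' ∈ chains (boundedVietoris A b r (q ^ k * R)) n, bdry z' = 0 ∧
      ∃ w ∈ chains (vietoris A ε) (n + 1), bdry w = z + z' := by
    intro k
    induction k with
    | zero => exact ⟨z, by simpa using hzr, hz0, 0, Submodule.zero_mem _,
        by rw [map_zero, ZModModule.add_self]⟩
    | succ k ih =>
      obtain ⟨z', hz', hz'0, w, hw, hwz⟩ := ih
      have hle : (1 - q) * (q ^ k * R) ≤ (1 - q) * R :=
        mul_le_mul_of_nonneg_left (mul_le_of_le_one_left hR0 (pow_le_one₀ hq0 hq1.le))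
          (by linarith)
      obtain ⟨z'', hz'', hz''0, w', hw', hwz'⟩ :=
        exists_homologous_contraction hA hrε hq0 hq1.le (hle.trans_lt hq) hz' hz'0
      refine ⟨z'', by rwa [pow_succ', mul_assoc], hz''0, w + w', Submodule.add_mem _ hw hw', ?_⟩
      rw [map_add, hwz, hwz', add_assoc, ← add_assoc z', ZModModule.add_self, zero_add]
  obtain ⟨k, hk⟩ : ∃ k : ℕ, q ^ k * R < ε := by
    have := (tendsto_pow_atTop_nhds_zero_of_lt_one hq0 hq1).mul_const R
    rw [zero_mul] at this
    exact (this.eventually_lt_const hε).exists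
  obtain ⟨z', hz', hz'0, w, hw, hwz⟩ := hiter k
  obtain ⟨w', hw', hwz'⟩ := exists_bdry_eq_of_insert_mem (B := vietoris A ε) (b := b)
    (fun σ hσ => ⟨by
      rw [Finset.coe_insert]
      exact Set.insert_subset hb hσ.1, fun x hx y hy => by
      rcases Finset.mem_insert.1 hx with rfl | hx' <;>
        rcases Finset.mem_insert.1 hy with rfl | hy'
      · simpa using hε
      · rw [dist_comm]
        exact (hσ.2.2 y hy').trans_lt hk
      · exact (hσ.2.2 x hx').trans_lt hk
      · exact (hσ.2.1 x hx' y hy').trans_lt hrε⟩) hz' hz'0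
  refine ⟨w + w', Submodule.add_mem _ hw hw', ?_⟩
  rw [map_add, hwz, hwz', add_assoc, ZModModule.add_self, add_zero]

end Vietoris

section Transfer

variable {F G : Type*} [AddCommGroup F] [Module ℝ F] [AddCommGroup G] [Module ℝ G]

/-- The simplicial chains of `S` as chains on the finite subsets of the ambient space. -/
noncomputable def toFChain (S : GeomComplex F) (m : ℕ) : S.Chain m →ₗ[ZMod 2] FChain F :=
  Fintype.linearCombination (ZMod 2) fun σ : S.Simp m => el σ.1

/-- Restriction of a chain to the `m`-simplices of `S`. -/
noncomputable def ofFChain (S : GeomComplex F) (m : ℕ) : FChain F →ₗ[ZMod 2] S.Chain m where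
  toFun c σ := c σ.1
  map_add' _ _ := rfl
  map_smul' _ _ := rfl

/-- The faces of `S` together with the empty set. -/
def augFaces (S : GeomComplex F) : Set (Finset F) := {σ | σ = ∅ ∨ σ ∈ S.faces}

lemma downClosed_augFaces (S : GeomComplex F) : DownClosed (augFaces S) := by
  rintro σ hσ τ hτ
  rcases τ.eq_empty_or_nonempty with rfl | hne
  · exact Or.inl rfl
  · rcases hσ with rfl | hσ
    · exact absurd (Finset.subset_empty.1 hτ) hne.ne_empty
    · exact Or.inr (S.down_closed σ hσ τ hτ hne)

lemma toFChain_single (S : GeomComplex F) {m : ℕ} (σ : S.Simp m) :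
    toFChain S m (Pi.single σ 1) = el σ.1 := by
  rw [toFChain, Fintype.linearCombination_apply_single, one_smul]

lemma ofFChain_el (S : GeomComplex F) {m : ℕ} (σ : S.Simp m) :
    ofFChain S m (el σ.1) = Pi.single σ 1 := by
  funext τ
  change Finsupp.single σ.1 (1 : ZMod 2) τ.1 = _
  rw [Finsupp.single_apply, Pi.single_apply]
  exact if_congr (eq_comm.trans Subtype.ext_iff.symm) rfl rfl

lemma ofFChain_toFChain (S : GeomComplex F) {m : ℕ} (c : S.Chain m) :
    ofFChain S m (toFChain S m c) = c := by
  have : ofFChain S m ∘ₗ toFChain S m = LinearMap.id :=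
    LinearMap.pi_ext' fun σ => LinearMap.ext_ring (by simp [toFChain_single, ofFChain_el])
  exact LinearMap.congr_fun this c

lemma toFChain_injective (S : GeomComplex F) (m : ℕ) : Function.Injective (toFChain S m) :=
  Function.LeftInverse.injective (ofFChain_toFChain S)

lemma toFChain_ofFChain (S : GeomComplex F) {m : ℕ} {c : FChain F}
    (hc : c ∈ chains (augFaces S) (m + 1)) : toFChain S m (ofFChain S m c) = c := by
  refine eq_on_chains (F := toFChain S m ∘ₗ ofFChain S m) (G := LinearMap.id) ?_ hc
  intro σ hσ hn
  have hσ' : σ ∈ S.faces := hσ.resolve_left (by rintro rfl; simp at hn)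
  have := ofFChain_el S (⟨σ, hσ', hn⟩ : S.Simp m)
  simp only at this
  rw [LinearMap.comp_apply, this, toFChain_single, LinearMap.id_apply]

lemma toFChain_mem (S : GeomComplex F) {m : ℕ} (c : S.Chain m) :
    toFChain S m c ∈ chains (augFaces S) (m + 1) := by
  rw [toFChain, Fintype.linearCombination_apply]
  exact Submodule.sum_mem _ fun σ _ =>
    Submodule.smul_mem _ _ (el_mem_chains (Or.inr σ.2.1) σ.2.2)

lemma toFChain_bd (S : GeomComplex F) {m : ℕ} (c : S.Chain (m + 1)) :
    toFChain S m (S.bd (m + 1) c) = bdry (toFChain S (m + 1) c) := by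
  have : toFChain S m ∘ₗ (S.bd (m + 1) : S.Chain (m + 1) →ₗ[ZMod 2] S.Chain m) =
      bdry ∘ₗ toFChain S (m + 1) := by
    refine LinearMap.pi_ext' fun σ => LinearMap.ext_ring ?_
    simp only [LinearMap.comp_apply, LinearMap.coe_single, toFChain_single, bdry_el]
    have hbd : (S.bd (m + 1) (Pi.single σ 1) : S.Chain m) =
        fun τ : S.Simp m => if τ.1 ⊆ σ.1 then 1 else 0 := by
      funext τ
      change (∑ ρ : S.Simp (m + 1), if τ.1 ⊆ ρ.1 then
        (Pi.single σ 1 : S.Chain (m + 1)) ρ else 0) = _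
      rw [Finset.sum_eq_single σ]
      · rw [Pi.single_eq_same]
      · intro ρ _ hρ
        rw [Pi.single_eq_of_ne hρ, ite_self]
      · exact fun h => absurd (Finset.mem_univ _) h
    refine (congrArg (toFChain S m) hbd).trans ?_
    rw [toFChain, Fintype.linearCombination_apply]
    simp only [ite_smul, one_smul, zero_smul]
    rw [← Finset.sum_filter]
    have hcard : ∀ v ∈ σ.1, (σ.1.erase v).card = m + 1 := fun v hv => by
      rw [Finset.card_erase_of_mem hv, σ.2.2, Nat.add_sub_cancel]
    symm
    refine Finset.sum_bij (fun v hv => ⟨σ.1.erase v, S.down_closed σ.1 σ.2.1 _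
      (Finset.erase_subset _ _) (Finset.card_pos.1 (by rw [hcard v hv]; omega)), hcard v hv⟩)
      ?_ ?_ ?_ ?_
    · exact fun v hv => Finset.mem_filter.2 ⟨Finset.mem_univ _, Finset.erase_subset _ _⟩
    · exact fun v hv w hw h => Finset.erase_injOn _ hv hw (congrArg Subtype.val h)
    · intro τ hτ
      have hτσ := (Finset.mem_filter.1 hτ).2
      have h1 : (σ.1 \ τ.1).card = 1 := by
        rw [Finset.card_sdiff_of_subset hτσ, σ.2.2, τ.2.2]
        omega
      obtain ⟨v, hv⟩ := Finset.card_eq_one.1 h1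
      refine ⟨v, Finset.sdiff_subset (hv ▸ Finset.mem_singleton_self v), Subtype.ext ?_⟩
      change σ.1.erase v = τ.1
      rw [← Finset.sdiff_singleton_eq_erase, ← hv, Finset.sdiff_sdiff_eq_self hτσ]
    · exact fun _ _ => rfl
  exact LinearMap.congr_fun this c

lemma mem_bdries_iff (S : GeomComplex F) {m : ℕ} (z : S.Chain m) :
    z ∈ S.bdries m ↔ ∃ c ∈ chains (augFaces S) (m + 2), bdry c = toFChain S m z := by
  constructor
  · rintro ⟨w, rfl⟩
    exact ⟨_, toFChain_mem S w, (toFChain_bd S w).symm⟩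
  · rintro ⟨c, hc, h⟩
    refine ⟨ofFChain S (m + 1) c, toFChain_injective S m ?_⟩
    rw [← h]
    exact (toFChain_bd S _).trans (congrArg bdry (toFChain_ofFChain S hc))

lemma mem_cycles_iff (S : GeomComplex F) {m : ℕ} (z : S.Chain m) :
    z ∈ S.cycles m ↔ ∃ t : ZMod 2, bdry (toFChain S m z) = t • el ∅ := by
  cases m with
  | zero =>
    refine iff_of_true (by simp [GeomComplex.cycles]) ?_
    have h : chains (augFaces S) 0 ≤ Submodule.span (ZMod 2) {el ∅} := chains_le fun σ _ hσ => by
      rw [Finset.card_eq_zero.1 hσ]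
      exact Submodule.mem_span_singleton_self _
    obtain ⟨t, ht⟩ := Submodule.mem_span_singleton.1
      (h (bdry_mem_chains (downClosed_augFaces S) (toFChain_mem S z)))
    exact ⟨t, ht.symm⟩
  | succ k =>
    rw [GeomComplex.cycles, if_neg (Nat.succ_ne_zero k), LinearMap.mem_ker, ← toFChain_bd]
    constructor
    · intro h
      exact ⟨0, by rw [zero_smul]; exact (congrArg (toFChain S k) h).trans (map_zero _)⟩
    · rintro ⟨t, ht⟩
      have h := congrArg (ofFChain S k) ht
      rw [ofFChain_toFChain, map_smul] at h
      refine h.trans ?_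
      have h0 : ofFChain S k (el ∅) = 0 := by
        funext σ
        exact Finsupp.single_eq_of_ne (S.nonempty_of_mem _ σ.2.1).ne_empty
      rw [h0, smul_zero]

/-- The homology of `S` in degree `m`. -/
abbrev Homology (S : GeomComplex F) (m : ℕ) : Type _ :=
  ↥(S.cycles m) ⧸ (S.bdries m).comap (S.cycles m).subtype

/-- A homotopy left inverse on chains bounds the dimension of homology. -/
lemma finrank_homology_le {S : GeomComplex F} {Q : GeomComplex G}
    {T : FChain F →ₗ[ZMod 2] FChain G} {T' : FChain G →ₗ[ZMod 2] FChain F}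
    (hT : IsCarried (augFaces S) (fun _ => augFaces Q) T)
    (hT' : IsCarried (augFaces Q) (fun _ => augFaces S) T')
    (hTT' : Homotopic (augFaces S) (augFaces S) (T' ∘ₗ T) LinearMap.id) (m : ℕ) :
    Module.finrank (ZMod 2) (Homology S m) ≤ Module.finrank (ZMod 2) (Homology Q m) := by
  let f : S.Chain m →ₗ[ZMod 2] Q.Chain m := ofFChain Q m ∘ₗ T ∘ₗ toFChain S m
  have hf : ∀ z, toFChain Q m (f z) = T (toFChain S m z) := fun z =>
    toFChain_ofFChain Q (hT.map_mem (toFChain_mem S z))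
  have hcyc : ∀ z ∈ S.cycles m, f z ∈ Q.cycles m := by
    intro z hz
    obtain ⟨t, ht⟩ := (mem_cycles_iff S z).1 hz
    exact (mem_cycles_iff Q _).2 ⟨t, by
      rw [hf, hT.comm_of_mem (toFChain_mem S z), ht, map_smul, hT.empty]⟩
  have hbdry : ∀ z ∈ S.bdries m, f z ∈ Q.bdries m := by
    intro z hz
    obtain ⟨c, hc, h⟩ := (mem_bdries_iff S z).1 hz
    exact (mem_bdries_iff Q _).2 ⟨T c, hT.map_mem hc, by rw [hf, hT.comm_of_mem hc, h]⟩
  have hinj : ∀ z ∈ S.cycles m, f z ∈ Q.bdries m → z ∈ S.bdries m := by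
    intro z hz hfz
    obtain ⟨t, ht⟩ := (mem_cycles_iff S z).1 hz
    obtain ⟨c, hc, h⟩ := (mem_bdries_iff Q _).1 hfz
    obtain ⟨u, hu, hu'⟩ := hTT'.exists_bdry_eq (toFChain_mem S z) ht
    refine (mem_bdries_iff S z).2 ⟨T' c + u, Submodule.add_mem _ (hT'.map_mem hc) hu, ?_⟩
    rw [map_add, hT'.comm_of_mem hc, h, hf, hu', LinearMap.comp_apply, LinearMap.id_apply,
      ← add_assoc, ZModModule.add_self, zero_add]
  let φ : Homology S m →ₗ[ZMod 2] Homology Q m :=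
    Submodule.mapQ _ _ (f.restrict hcyc) fun z hz => hbdry z.1 hz
  refine LinearMap.finrank_le_finrank_of_injective (f := φ) ?_
  rw [injective_iff_map_eq_zero]
  intro x hx
  induction x using Submodule.Quotient.induction_on with
  | _ z =>
    exact (Submodule.Quotient.mk_eq_zero _).2
      (hinj z.1 z.2 ((Submodule.Quotient.mk_eq_zero
        ((Q.bdries m).comap (Q.cycles m).subtype) (x := f.restrict hcyc z)).1 hx))

end Transfer

section Complex

variable {F : Type*} [NormedAddCommGroup F] [NormedSpace ℝ F]

lemma convexHull_subset_space {S : GeomComplex F} {σ : Finset F} (hσ : σ ∈ augFaces S) :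
    convexHull ℝ (σ : Set F) ⊆ S.space := by
  rcases hσ with rfl | hσ
  · simp
  · exact Set.subset_biUnion_of_mem (u := fun σ : Finset F => convexHull ℝ (σ : Set F)) hσ

lemma isCompact_space (S : GeomComplex F) : IsCompact S.space :=
  S.faces.isCompact_biUnion fun σ _ => σ.finite_toSet.isCompact_convexHull (𝕜 := ℝ)

/-- Every point of the polyhedron lies in a smallest simplex. -/
lemma exists_carrier (S : GeomComplex F) : ∃ carr : F → Finset F, ∀ x ∈ S.space, carr x ∈ S.faces ∧
    x ∈ convexHull ℝ (carr x : Set F) ∧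
    ∀ σ ∈ S.faces, x ∈ convexHull ℝ (σ : Set F) → carr x ⊆ σ := by
  have key : ∀ x : F, ∃ τ : Finset F, x ∈ S.space → τ ∈ S.faces ∧
      x ∈ convexHull ℝ (τ : Set F) ∧
      ∀ σ ∈ S.faces, x ∈ convexHull ℝ (σ : Set F) → τ ⊆ σ := by
    intro x
    by_cases hx : x ∈ S.space
    · obtain ⟨σ₀, hσ₀, hx₀⟩ := Set.mem_iUnion₂.1 hx
      obtain ⟨τ, hτ, hmin⟩ := Finset.exists_min_image
        (S.faces.filter fun σ : Finset F => x ∈ convexHull ℝ (σ : Set F)) Finset.card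
        ⟨σ₀, Finset.mem_filter.2 ⟨hσ₀, hx₀⟩⟩
      rw [Finset.mem_filter] at hτ
      refine ⟨τ, fun _ => ⟨hτ.1, hτ.2, fun σ hσ hxσ => ?_⟩⟩
      have hxi : x ∈ convexHull ℝ ((τ ∩ σ : Finset F) : Set F) := by
        rw [← S.inter_face τ hτ.1 σ hσ]
        exact ⟨hτ.2, hxσ⟩
      have hne : (τ ∩ σ).Nonempty := by
        have := convexHull_nonempty_iff.1 ⟨x, hxi⟩
        exact_mod_cast this
      have hle := hmin (τ ∩ σ) (Finset.mem_filter.2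
        ⟨S.down_closed τ hτ.1 _ Finset.inter_subset_left hne, hxi⟩)
      exact Finset.inter_eq_left.1 (Finset.eq_of_subset_of_card_le Finset.inter_subset_left hle)
    · exact ⟨∅, fun h => absurd h hx⟩
  choose carr hcarr using key
  exact ⟨carr, hcarr⟩

/-- The Lebesgue number lemma for the open star cover: nearby points of the polyhedron have a
common vertex in their carriers. -/
lemma exists_carrier_vertex (S : GeomComplex F) : ∃ (carr : F → Finset F) (v : F → F) (ε : ℝ), 0 < ε ∧
    (∀ x ∈ S.space, carr x ∈ S.faces ∧ x ∈ convexHull ℝ (carr x : Set F) ∧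
      ∀ σ ∈ S.faces, x ∈ convexHull ℝ (σ : Set F) → carr x ⊆ σ) ∧
    ∀ x ∈ S.space, ∀ y ∈ S.space, dist x y < ε → v x ∈ carr y := by
  obtain ⟨carr, hcarr⟩ := exists_carrier S
  let c : F → Set F := fun v => (⋃ σ ∈ S.faces.filter (v ∉ ·), convexHull ℝ (σ : Set F))ᶜ
  have hc : ∀ v, IsOpen (c v) := fun v => isOpen_compl_iff.2
    (Set.Finite.isClosed_biUnion (Finset.finite_toSet _)
      fun σ _ => (σ.finite_toSet.isCompact_convexHull (𝕜 := ℝ)).isClosed)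
  have hmem : ∀ x ∈ S.space, ∀ v, x ∈ c v ↔ v ∈ carr x := by
    intro x hx v
    obtain ⟨h1, h2, h3⟩ := hcarr x hx
    simp only [c, Set.mem_compl_iff, Set.mem_iUnion, Finset.mem_filter, not_exists]
    constructor
    · intro h
      by_contra hv
      exact h _ ⟨h1, hv⟩ h2
    · exact fun hv σ hσ hxσ => hσ.2 (h3 σ hσ.1 hxσ hv)
  obtain ⟨ε, hε, h⟩ := lebesgue_number_lemma_of_metric (isCompact_space S) hc fun x hx => by
    obtain ⟨v, hv⟩ := S.nonempty_of_mem _ (hcarr x hx).1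
    exact Set.mem_iUnion.2 ⟨v, (hmem x hx v).2 hv⟩
  choose! v hv using h
  refine ⟨carr, v, ε, hε, hcarr, fun x hx y hy hxy => (hmem y hy _).1 (hv x hx ?_)⟩
  rwa [Metric.mem_ball, dist_comm]

/-- The fine subdivision chain map from a complex to the Vietoris–Rips complex of its
polyhedron. -/
lemma exists_isCarried_vietoris (S : GeomComplex F) {ε : ℝ} (hε : 0 < ε) :
    ∃ P : FChain F →ₗ[ZMod 2] FChain F,
      IsCarried (augFaces S) (fun σ => vietoris (convexHull ℝ (σ : Set F)) ε) P := by
  refine exists_isCarried (downClosed_augFaces S)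
    (fun σ _ τ hτ => vietoris_mono (convexHull_mono (Finset.coe_subset.2 hτ)) ε) ?_
    (empty_mem_vietoris _ _)
  rintro σ _ ⟨b, hb⟩
  have hb' : b ∈ convexHull ℝ (σ : Set F) := subset_convexHull ℝ _ hb
  exact acyclic_vietoris ((convex_convexHull ℝ _).starConvex hb') hb' hε

end Complex

section Comparison

variable {F G : Type*} [NormedAddCommGroup F] [NormedSpace ℝ F] [NormedAddCommGroup G]
  [NormedSpace ℝ G]

/-- At small scales, approximating by vertices and subdividing again is homotopic to the
identity. -/
lemma homotopic_subdivision_comp_approximation {S : GeomComplex F} {carr : F → Finset F}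
    {v : F → F} {ε : ℝ} (hε : 0 < ε)
    (hcarr : ∀ x ∈ S.space, carr x ∈ S.faces ∧ x ∈ convexHull ℝ (carr x : Set F) ∧
      ∀ σ ∈ S.faces, x ∈ convexHull ℝ (σ : Set F) → carr x ⊆ σ)
    (hv : ∀ x ∈ S.space, ∀ y ∈ S.space, dist x y < ε → v x ∈ carr y)
    {P A : FChain F →ₗ[ZMod 2] FChain F}
    (hP : IsCarried (augFaces S) (fun σ => vietoris (convexHull ℝ (σ : Set F)) ε) P)
    (hA : IsCarried (vietoris S.space ε) (fun σ => simplex (σ.image v)) A) :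
    Homotopic (vietoris S.space ε) (vietoris S.space ε) (P ∘ₗ A) LinearMap.id := by
  let U : Finset F → Set F := fun σ => ⋃ x ∈ σ, convexHull ℝ (carr x : Set F)
  have hsub : ∀ σ ∈ vietoris S.space ε, ∀ x ∈ σ, σ.image v ⊆ carr x := by
    intro σ hσ x hx w hw
    obtain ⟨y, hy, rfl⟩ := Finset.mem_image.1 hw
    exact hv y (hσ.1 hy) x (hσ.1 hx) (hσ.2 y hy x hx)
  have hU : ∀ σ ∈ vietoris S.space ε, U σ ⊆ S.space := fun σ hσ =>
    Set.iUnion₂_subset fun x hx => convexHull_subset_space (Or.inr (hcarr x (hσ.1 hx)).1)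
  refine IsCarried.homotopic (Φ := fun σ => vietoris (U σ) ε) (downClosed_vietoris _ _) ?_ ?_
    (fun σ hσ => vietoris_mono (hU σ hσ) ε) ?_ (isCarried_id fun σ hσ => ⟨?_, hσ.2⟩)
  · exact fun σ _ τ hτ => vietoris_mono (Set.biUnion_subset_biUnion_left hτ) ε
  · rintro σ hσ ⟨x, hx⟩
    have hmem : ∀ y ∈ σ, v x ∈ convexHull ℝ (carr y : Set F) := fun y hy =>
      subset_convexHull ℝ _ (hsub σ hσ y hy (Finset.mem_image_of_mem v hx))
    exact acyclic_vietoris (starConvex_iUnion₂ fun y hy =>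
      (convex_convexHull ℝ _).starConvex (hmem y hy)) (Set.mem_biUnion hx (hmem x hx)) hε
  · refine hP.comp hA (fun σ hσ τ hτ => ?_) fun σ hσ τ hτ => vietoris_mono ?_ ε
    · rcases σ.eq_empty_or_nonempty with rfl | ⟨x, hx⟩
      · exact Or.inl (Finset.subset_empty.1 (by simpa [simplex] using hτ))
      · exact downClosed_augFaces S _ (Or.inr (hcarr x (hσ.1 hx)).1) τ
          (Finset.Subset.trans hτ (hsub σ hσ x hx))
    · rcases σ.eq_empty_or_nonempty with rfl | ⟨x, hx⟩
      · obtain rfl : τ = ∅ := Finset.subset_empty.1 (by simpa [simplex] using hτ)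
        simp
      · exact (convexHull_mono (Finset.coe_subset.2
          (Finset.Subset.trans hτ (hsub σ hσ x hx)))).trans
          (Set.subset_biUnion_of_mem (u := fun x => convexHull ℝ (carr x : Set F)) hx)
  · exact fun x hx => Set.mem_biUnion hx (hcarr x (hσ.1 hx)).2.1

/-- At small scales, approximation by vertices is a simplicial map from the Vietoris–Rips complex
of the polyhedron to the complex. -/
lemma simplex_image_subset_augFaces {S : GeomComplex F} {carr : F → Finset F}
    {v : F → F} {ε : ℝ} (hcarr : ∀ x ∈ S.space, carr x ∈ S.faces)
    (hv : ∀ x ∈ S.space, ∀ y ∈ S.space, dist x y < ε → v x ∈ carr y) {σ : Finset F}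
    (hσ : σ ∈ vietoris S.space ε) : simplex (σ.image v) ⊆ augFaces S := by
  intro τ hτ
  rcases σ.eq_empty_or_nonempty with rfl | ⟨x, hx⟩
  · exact Or.inl (Finset.subset_empty.1 (by simpa [simplex] using hτ))
  · refine downClosed_augFaces S _ (Or.inr (hcarr x (hσ.1 hx))) τ (Finset.Subset.trans hτ ?_)
    intro w hw
    obtain ⟨y, hy, rfl⟩ := Finset.mem_image.1 hw
    exact hv y (hσ.1 hy) x (hσ.1 hx) (hσ.2 y hy x hx)

/-- Complexes with homeomorphic polyhedra are related by chain maps, one composite of which is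
homotopic to the identity. -/
theorem exists_chainMap_of_homeomorph (S : GeomComplex F) (Q : GeomComplex G)
    (e : S.space ≃ₜ Q.space) :
    ∃ (T : FChain F →ₗ[ZMod 2] FChain G) (T' : FChain G →ₗ[ZMod 2] FChain F),
      IsCarried (augFaces S) (fun _ => augFaces Q) T ∧
      IsCarried (augFaces Q) (fun _ => augFaces S) T' ∧
      Homotopic (augFaces S) (augFaces S) (T' ∘ₗ T) LinearMap.id := by
  let f : F → G := fun x => if hx : x ∈ S.space then e ⟨x, hx⟩ else 0
  let g : G → F := fun y => if hy : y ∈ Q.space then e.symm ⟨y, hy⟩ else 0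
  have hf : ∀ x : S.space, f x = e x := fun x => dif_pos x.2
  have hg : ∀ y : Q.space, g y = e.symm y := fun y => dif_pos y.2
  have hfm : Set.MapsTo f S.space Q.space := fun x hx => hf ⟨x, hx⟩ ▸ (e ⟨x, hx⟩).2
  have hgm : Set.MapsTo g Q.space S.space := fun y hy => hg ⟨y, hy⟩ ▸ (e.symm ⟨y, hy⟩).2
  have hgf : ∀ x ∈ S.space, g (f x) = x := fun x hx => by
    rw [hf ⟨x, hx⟩, hg, e.symm_apply_apply]
  obtain ⟨carrS, vS, εS, hεS, hcS, hvS⟩ := exists_carrier_vertex S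
  obtain ⟨carrQ, vQ, εQ, hεQ, hcQ, hvQ⟩ := exists_carrier_vertex Q
  obtain ⟨δ₀, hδ₀, hgu⟩ :=
    exists_uniform_extension (isCompact_space Q) e.symm e.symm.continuous g hg hεS
  obtain ⟨δ, hδ, hδQ, hδδ₀⟩ : ∃ δ > 0, δ ≤ εQ ∧ δ ≤ δ₀ :=
    ⟨min εQ δ₀, lt_min hεQ hδ₀, min_le_left _ _, min_le_right _ _⟩
  replace hgu : ∀ x ∈ Q.space, ∀ y ∈ Q.space, dist x y < δ → dist (g x) (g y) < εS :=
    fun x hx y hy hxy => hgu x hx y hy (hxy.trans_le hδδ₀)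
  replace hvQ : ∀ x ∈ Q.space, ∀ y ∈ Q.space, dist x y < δ → vQ x ∈ carrQ y :=
    fun x hx y hy hxy => hvQ x hx y hy (hxy.trans_le hδQ)
  obtain ⟨ε, hε, hfu⟩ := exists_uniform_extension (isCompact_space S) e e.continuous f hf hδ
  obtain ⟨PS, hPS⟩ := exists_isCarried_vietoris S hε
  obtain ⟨PQ, hPQ⟩ := exists_isCarried_vietoris Q hδ
  obtain ⟨AS, hAS⟩ := exists_isCarried_simplex_image (downClosed_vietoris S.space εS) vS
  obtain ⟨AQ, hAQ⟩ := exists_isCarried_simplex_image (downClosed_vietoris Q.space δ) vQ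
  obtain ⟨H, hH⟩ := exists_isCarried_simplex_image (downClosed_vietoris S.space ε) f
  obtain ⟨H', hH'⟩ := exists_isCarried_simplex_image (downClosed_vietoris Q.space δ) g
  have hPS' := fun σ (hσ : σ ∈ augFaces S) => vietoris_mono (convexHull_subset_space hσ) ε
  have hPQ' := fun σ (hσ : σ ∈ augFaces Q) => vietoris_mono (convexHull_subset_space hσ) δ
  have hAS' := fun σ (hσ : σ ∈ vietoris S.space εS) =>
    simplex_image_subset_augFaces (fun x hx => (hcS x hx).1) hvS hσ
  have hAQ' := fun σ (hσ : σ ∈ vietoris Q.space δ) =>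
    simplex_image_subset_augFaces (fun x hx => (hcQ x hx).1) hvQ hσ
  have hHs := fun σ (hσ : σ ∈ vietoris S.space ε) => simplex_image_subset_vietoris hfm hfu hσ
  have hHs' := fun σ (hσ : σ ∈ vietoris Q.space δ) => simplex_image_subset_vietoris hgm hgu hσ
  have hHP : IsCarried (augFaces S) (fun _ => vietoris Q.space δ) (H ∘ₗ PS) :=
    hH.comp hPS hPS' fun σ hσ τ hτ => hHs τ (hPS' σ hσ hτ)
  have hAH : IsCarried (vietoris Q.space δ) (fun _ => augFaces S) (AS ∘ₗ H') :=
    hAS.comp hH' hHs' fun σ hσ τ hτ => hAS' τ (hHs' σ hσ hτ)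
  refine ⟨AQ ∘ₗ (H ∘ₗ PS), (AS ∘ₗ H') ∘ₗ PQ,
    hAQ.comp hHP (fun _ _ => Set.Subset.rfl) fun _ _ => hAQ',
    hAH.comp hPQ hPQ' fun _ _ _ _ => Set.Subset.rfl, ?_⟩
  have h₁ : Homotopic (augFaces S) (augFaces S) (((AS ∘ₗ H') ∘ₗ (PQ ∘ₗ AQ)) ∘ₗ (H ∘ₗ PS))
      (((AS ∘ₗ H') ∘ₗ LinearMap.id) ∘ₗ (H ∘ₗ PS)) :=
    ((homotopic_subdivision_comp_approximation hδ hcQ hvQ hPQ hAQ).comp_left hAH).comp_right hHP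
  refine Homotopic.trans h₁ ?_
  have hHP' : IsCarried (augFaces S) (fun σ => {τ | τ ∈ vietoris Q.space δ ∧
      ∀ y ∈ τ, g y ∈ convexHull ℝ (σ : Set F)}) (H ∘ₗ PS) := by
    refine hH.comp hPS hPS' fun σ hσ τ hτ ρ hρ => ⟨hHs τ (hPS' σ hσ hτ) hρ, fun y hy => ?_⟩
    obtain ⟨x, hx, rfl⟩ := Finset.mem_image.1 (hρ hy)
    rw [hgf x (convexHull_subset_space hσ (hτ.1 hx))]
    exact hτ.1 hx
  have hAH' : IsCarried (vietoris Q.space δ) (fun τ => simplex ((τ.image g).image vS))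
      (AS ∘ₗ H') :=
    hAS.comp hH' hHs' fun σ hσ τ hτ ρ hρ => Finset.Subset.trans hρ (Finset.image_subset_image hτ)
  refine IsCarried.homotopic (Φ := simplex) (downClosed_augFaces S)
    (fun _ _ _ hτ _ hρ => Finset.Subset.trans hρ hτ) (fun _ _ hne => acyclic_simplex hne)
    (fun σ hσ τ hτ => downClosed_augFaces S σ hσ τ hτ) ?_
    (isCarried_id fun _ _ => Finset.Subset.refl _)
  refine hAH'.comp hHP' (fun σ _ τ hτ => hτ.1) ?_
  rintro σ hσ τ hτ ρ hρ w hw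
  obtain ⟨x, hx, rfl⟩ := Finset.mem_image.1 (hρ hw)
  obtain ⟨y, hy, rfl⟩ := Finset.mem_image.1 hx
  have hgy := hgm (hτ.1.1 hy)
  have hmem := hvS _ hgy _ hgy (by simpa using hεS)
  rcases hσ with rfl | hσ
  · simpa using hτ.2 y hy
  · exact (hcS _ hgy).2.2 σ hσ (hτ.2 y hy) hmem

end Comparison

end SimplicialInvariance

/-- Topological invariance of simplicial homology: if the polyhedra of geometric
simplicial complexes `S` and `Q` are homeomorphic, then for every `m ≥ 0` the
`𝔽₂`-homology groups `H_m(S) = Z_m(S)/B_m(S)` and `H_m(Q) = Z_m(Q)/B_m(Q)` are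
isomorphic as `𝔽₂`-vector spaces. -/
theorem homology_topological_invariance (d e : ℕ)
    (S : GeomComplex (EuclideanSpace ℝ (Fin d)))
    (Q : GeomComplex (EuclideanSpace ℝ (Fin e)))
    (h : Nonempty (↥S.space ≃ₜ ↥Q.space)) (m : ℕ) :
    Nonempty
      ((↥(S.cycles m) ⧸ (S.bdries m).comap (S.cycles m).subtype) ≃ₗ[ZMod 2]
        (↥(Q.cycles m) ⧸ (Q.bdries m).comap (Q.cycles m).subtype)) := by
  obtain ⟨f⟩ := h
  obtain ⟨T, T', hT, hT', hTT'⟩ := SimplicialInvariance.exists_chainMap_of_homeomorph S Q f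
  obtain ⟨R, R', hR, hR', hRR'⟩ := SimplicialInvariance.exists_chainMap_of_homeomorph Q S f.symm
  exact FiniteDimensional.nonempty_linearEquiv_of_finrank_eq
    (le_antisymm (SimplicialInvariance.finrank_homology_le hT hT' hTT' m)
      (SimplicialInvariance.finrank_homology_le hR hR' hRR' m))
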